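/- (Foata–Schützenberger) Every Ferrers board is rook equivalent to a unique increasing Ferrers board; that is, for every Ferrers board B there exists an increasing Ferrers board B' with r_k(B) = r_k(B') for all k, and any two increasing Ferrers boards that are rook equivalent have the same height vector (up to columns of zero height). -/

import Mathlib

/-- A board is a finite subset of ℕ × ℕ.  `rookNum B k` is the number of placements of `k`
non-attacking rooks on `B`. -/
def rookNum (B : Finset (ℕ × ℕ)) (k : ℕ) : ℕ :=
  (B.powerset.filter (fun P => P.card = k ∧
    ∀ p ∈ P, ∀ q ∈ P, p ≠ q → p.1 ≠ q.1 ∧ p.2 ≠ q.2)).card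

/-- The Ferrers board with `c` columns of heights `h 1, …, h c`. -/
def ferrersBoard (c : ℕ) (h : ℕ → ℕ) : Finset (ℕ × ℕ) :=
  (Finset.Icc 1 c).biUnion (fun i => ({i} : Finset ℕ) ×ˢ Finset.Icc 1 (h i))

/-- The list of nonzero column heights of the Ferrers board with heights `h 1, …, h c`;
two height vectors agree "up to columns of zero height" iff these lists agree. -/
def nonzeroHeights (c : ℕ) (h : ℕ → ℕ) : List ℕ :=
  ((List.range c).map (fun i => h (i + 1))).filter (fun x => x != 0)

/-- The placements counted by `rookNum B k`. -/
def rookPlacements (B : Finset (ℕ × ℕ)) (k : ℕ) : Finset (Finset (ℕ × ℕ)) :=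
  B.powerset.filter (fun P => P.card = k ∧
    ∀ p ∈ P, ∀ q ∈ P, p ≠ q → p.1 ≠ q.1 ∧ p.2 ≠ q.2)

lemma mem_rookPlacements {B P : Finset (ℕ × ℕ)} {k : ℕ} :
    P ∈ rookPlacements B k ↔ P ⊆ B ∧ P.card = k ∧
      ∀ p ∈ P, ∀ q ∈ P, p ≠ q → p.1 ≠ q.1 ∧ p.2 ≠ q.2 := by
  simp [rookPlacements]

lemma mem_ferrersBoard {c : ℕ} {h : ℕ → ℕ} {p : ℕ × ℕ} :
    p ∈ ferrersBoard c h ↔ (1 ≤ p.1 ∧ p.1 ≤ c) ∧ 1 ≤ p.2 ∧ p.2 ≤ h p.1 := by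
  obtain ⟨i, j⟩ := p
  simp only [ferrersBoard, Finset.mem_biUnion, Finset.mem_product, Finset.mem_singleton,
    Finset.mem_Icc]
  constructor
  · rintro ⟨a, ha, rfl, hj⟩
    exact ⟨ha, hj⟩
  · rintro ⟨hi, hj⟩
    exact ⟨i, hi, rfl, hj⟩

lemma rookNum_zero (B : Finset (ℕ × ℕ)) : rookNum B 0 = 1 := by
  rw [rookNum, Finset.card_eq_one]
  refine ⟨∅, ?_⟩
  ext P
  simp only [Finset.mem_filter, Finset.mem_powerset, Finset.card_eq_zero, Finset.mem_singleton]
  constructor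
  · exact fun hP => hP.2.1
  · rintro rfl
    simp

lemma rookNum_ferrersBoard_zero_succ (h : ℕ → ℕ) (k : ℕ) :
    rookNum (ferrersBoard 0 h) (k + 1) = 0 := by
  rw [rookNum, Finset.card_eq_zero]
  ext P
  simp only [ferrersBoard, Finset.mem_filter, Finset.mem_powerset]
  simp only [Finset.notMem_empty, iff_false]
  rintro ⟨hP, hc, -⟩
  have : P = ∅ := by simpa using hP
  simp [this] at hc

/-- Placements using a rook in the last column are obtained by adding a rook in a free row of
the last column to a placement on the other columns. -/
lemma card_rookPlacements_last_column {c k : ℕ} {h : ℕ → ℕ}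
    (hh : ∀ i, 1 ≤ i → i ≤ c → h i ≤ h (c + 1)) :
    ((rookPlacements (ferrersBoard (c + 1) h) (k + 1)).filter
      (fun P => ∃ p ∈ P, p.1 = c + 1)).card =
      (rookPlacements (ferrersBoard c h) k).card * (h (c + 1) - k) := by
  have hfree : ∀ Q ∈ rookPlacements (ferrersBoard c h) k,
      (Finset.Icc 1 (h (c + 1)) \ Q.image Prod.snd).card = h (c + 1) - k := by
    intro Q hQ
    obtain ⟨hQB, hQk, hQ⟩ := mem_rookPlacements.1 hQ
    rw [Finset.card_sdiff_of_subset, Nat.card_Icc, Finset.card_image_of_injOn, hQk]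
    · simp
    · intro p hp q hq hpq
      by_contra hne
      exact (hQ p hp q hq hne).2 hpq
    · intro j hj
      obtain ⟨p, hp, rfl⟩ := Finset.mem_image.1 hj
      have := mem_ferrersBoard.1 (hQB hp)
      have := hh p.1 this.1.1 this.1.2
      rw [Finset.mem_Icc]
      omega
  rw [← smul_eq_mul, ← Finset.sum_const, ← Finset.sum_congr rfl hfree, ← Finset.card_sigma]
  symm
  refine Finset.card_bij (fun x _ => insert (c + 1, x.2) x.1) ?_ ?_ ?_
  · rintro ⟨Q, j⟩ hx
    simp only [Finset.mem_sigma, Finset.mem_sdiff, Finset.mem_Icc, Finset.mem_image,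
      not_exists, not_and] at hx
    obtain ⟨hQ, hj, hjQ⟩ := hx
    obtain ⟨hQB, hQk, hQ⟩ := mem_rookPlacements.1 hQ
    have hcol : ∀ p ∈ Q, p.1 ≠ c + 1 := by
      intro p hp
      have := mem_ferrersBoard.1 (hQB hp)
      omega
    rw [Finset.mem_filter, mem_rookPlacements]
    refine ⟨⟨?_, ?_, ?_⟩, (c + 1, j), Finset.mem_insert_self _ _, rfl⟩
    · intro p hp
      rcases Finset.mem_insert.1 hp with rfl | hp
      · rw [mem_ferrersBoard]
        exact ⟨⟨by simp, le_rfl⟩, hj⟩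
      · have := mem_ferrersBoard.1 (hQB hp)
        rw [mem_ferrersBoard]
        omega
    · rw [Finset.card_insert_of_notMem, hQk]
      exact fun hmem => hcol _ hmem rfl
    · intro p hp q hq hpq
      rcases Finset.mem_insert.1 hp with rfl | hp <;> rcases Finset.mem_insert.1 hq with rfl | hq
      · exact absurd rfl hpq
      · exact ⟨(hcol q hq).symm, fun e => hjQ q hq e.symm⟩
      · exact ⟨hcol p hp, hjQ p hp⟩
      · exact hQ p hp q hq hpq
  · rintro ⟨Q, j⟩ hx ⟨Q', j'⟩ hx' heq
    simp only [Finset.mem_sigma] at hx hx' heq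
    have hcol : ∀ R ∈ rookPlacements (ferrersBoard c h) k, ∀ i, (c + 1, i) ∉ R := by
      intro R hR i hi
      have := mem_ferrersBoard.1 ((mem_rookPlacements.1 hR).1 hi)
      simp at this
    have hj : j = j' := by
      have hm : (c + 1, j) ∈ insert (c + 1, j') Q' := heq ▸ Finset.mem_insert_self _ _
      rcases Finset.mem_insert.1 hm with e | hm
      · exact (Prod.mk.inj e).2
      · exact absurd hm (hcol Q' hx'.1 j)
    subst hj
    have hQ : Q = Q' := by
      rw [← Finset.erase_insert (hcol Q hx.1 j), heq, Finset.erase_insert (hcol Q' hx'.1 j)]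
    rw [hQ]
  · intro P hP
    rw [Finset.mem_filter, mem_rookPlacements] at hP
    obtain ⟨⟨hPB, hPk, hP⟩, ⟨i, j⟩, hp, rfl⟩ := hP
    have hcell := mem_ferrersBoard.1 (hPB hp)
    refine ⟨⟨P.erase (c + 1, j), j⟩, ?_, Finset.insert_erase hp⟩
    simp only [Finset.mem_sigma, Finset.mem_sdiff, Finset.mem_Icc, Finset.mem_image,
      not_exists, not_and, mem_rookPlacements]
    refine ⟨⟨?_, ?_, ?_⟩, hcell.2, ?_⟩
    · intro q hq
      obtain ⟨hne, hq⟩ := Finset.mem_erase.1 hq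
      have h1 := mem_ferrersBoard.1 (hPB hq)
      have h2 := (hP q hq _ hp hne).1
      rw [mem_ferrersBoard]
      simp only at h2
      omega
    · rw [Finset.card_erase_of_mem hp, hPk, Nat.add_sub_cancel]
    · exact fun p hp q hq => hP p (Finset.mem_of_mem_erase hp) q (Finset.mem_of_mem_erase hq)
    · intro q hq
      obtain ⟨hne, hq⟩ := Finset.mem_erase.1 hq
      exact (hP q hq _ hp hne).2

lemma rookPlacements_filter_not_last_column (c k : ℕ) (h : ℕ → ℕ) :
    (rookPlacements (ferrersBoard (c + 1) h) k).filter (fun P => ¬ ∃ p ∈ P, p.1 = c + 1) =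
      rookPlacements (ferrersBoard c h) k := by
  ext P
  simp only [Finset.mem_filter, mem_rookPlacements, not_exists, not_and]
  constructor
  · rintro ⟨⟨hPB, hP⟩, hcol⟩
    refine ⟨fun p hp => ?_, hP⟩
    have h1 := mem_ferrersBoard.1 (hPB hp)
    have h2 := hcol p hp
    rw [mem_ferrersBoard]
    omega
  · rintro ⟨hPB, hP⟩
    refine ⟨⟨fun p hp => ?_, hP⟩, fun p hp => ?_⟩ <;>
    have h1 := mem_ferrersBoard.1 (hPB hp)
    · rw [mem_ferrersBoard]
      omega
    · omega

lemma rookNum_ferrersBoard_succ {c k : ℕ} {h : ℕ → ℕ}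
    (hh : ∀ i, 1 ≤ i → i ≤ c → h i ≤ h (c + 1)) :
    rookNum (ferrersBoard (c + 1) h) (k + 1) =
      rookNum (ferrersBoard c h) (k + 1) + rookNum (ferrersBoard c h) k * (h (c + 1) - k) := by
  change (rookPlacements _ _).card = (rookPlacements _ _).card + (rookPlacements _ _).card * _
  rw [← Finset.card_filter_add_card_filter_not (fun P => ∃ p ∈ P, p.1 = c + 1),
    card_rookPlacements_last_column hh, rookPlacements_filter_not_last_column, add_comm]

/-- A placement of `k` rooks occupies `k` rows. -/
lemma rookNum_eq_zero_of_lt {B : Finset (ℕ × ℕ)} {m k : ℕ}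
    (hB : ∀ p ∈ B, 1 ≤ p.2 ∧ p.2 ≤ m) (hk : m < k) : rookNum B k = 0 := by
  change (rookPlacements B k).card = 0
  rw [Finset.card_eq_zero, Finset.eq_empty_iff_forall_notMem]
  intro P hP
  obtain ⟨hPB, hPk, hP⟩ := mem_rookPlacements.1 hP
  have : P.card ≤ (Finset.Icc 1 m).card := by
    refine Finset.card_le_card_of_injOn Prod.snd
      (fun p hp => Finset.mem_coe.2 (Finset.mem_Icc.2 (hB p (hPB hp)))) ?_
    intro p hp q hq hpq
    by_contra hne
    exact (hP p hp q hq hne).2 hpq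
  rw [Nat.card_Icc] at this
  omega

/-- The rook numbers of the Ferrers board whose column heights, read from right to left, form a
given weakly decreasing list. -/
def listRookNum : List ℕ → ℕ → ℤ
  | [], 0 => 1
  | [], _ + 1 => 0
  | _ :: l, 0 => listRookNum l 0
  | a :: l, k + 1 => listRookNum l (k + 1) + listRookNum l k * (a - k)

/-- The column heights `h c, …, h 1`. -/
def heightList (h : ℕ → ℕ) : ℕ → List ℕ
  | 0 => []
  | c + 1 => h (c + 1) :: heightList h c

lemma mem_heightList {h : ℕ → ℕ} {c a : ℕ} :
    a ∈ heightList h c ↔ ∃ i, 1 ≤ i ∧ i ≤ c ∧ h i = a := by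
  induction c with
  | zero => simp [heightList]
  | succ c ih =>
    rw [heightList, List.mem_cons, ih]
    constructor
    · rintro (rfl | ⟨i, h1, h2, h3⟩)
      · exact ⟨c + 1, by omega, le_rfl, rfl⟩
      · exact ⟨i, h1, by omega, h3⟩
    · rintro ⟨i, h1, h2, rfl⟩
      rcases Nat.lt_or_ge c i with hi | hi
      · exact Or.inl (congrArg h (by omega))
      · exact Or.inr ⟨i, h1, hi, rfl⟩

lemma rookNum_ferrersBoard {h : ℕ → ℕ} {c : ℕ}
    (hmono : ∀ i j, 1 ≤ i → i ≤ j → j ≤ c → h i ≤ h j) (k : ℕ) :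
    (rookNum (ferrersBoard c h) k : ℤ) = listRookNum (heightList h c) k := by
  induction c generalizing k with
  | zero =>
    cases k with
    | zero => simp [rookNum_zero, heightList, listRookNum]
    | succ k => simp [rookNum_ferrersBoard_zero_succ, heightList, listRookNum]
  | succ c ih =>
    have ih := ih fun i j h1 h2 h3 => hmono i j h1 h2 (by omega)
    have hh : ∀ i, 1 ≤ i → i ≤ c → h i ≤ h (c + 1) :=
      fun i h1 h2 => hmono i (c + 1) h1 (by omega) le_rfl
    cases k with
    | zero => rw [heightList, listRookNum, ← ih 0, rookNum_zero, rookNum_zero]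
    | succ k =>
      rw [heightList, listRookNum, ← ih, ← ih, rookNum_ferrersBoard_succ hh]
      push_cast
      rcases Nat.lt_or_ge (h (c + 1)) k with hk | hk
      · rw [rookNum_eq_zero_of_lt (m := h (c + 1)) _ hk]
        · simp
        · intro p hp
          have := mem_ferrersBoard.1 hp
          have := hh p.1 this.1.1 this.1.2
          omega
      · rw [Nat.cast_sub hk]

lemma pairwise_heightList {h : ℕ → ℕ} {c : ℕ}
    (hlt : ∀ i j, 1 ≤ i → i < j → j ≤ c → h i < h j) :
    (heightList h c).Pairwise (· > ·) := by
  induction c with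
  | zero => exact List.Pairwise.nil
  | succ c ih =>
    refine List.pairwise_cons.2 ⟨fun a ha => ?_, ih fun i j h1 h2 h3 => hlt i j h1 h2 (by omega)⟩
    obtain ⟨i, h1, h2, rfl⟩ := mem_heightList.1 ha
    exact hlt i (c + 1) h1 (by omega) le_rfl

lemma heightList_congr {h h' : ℕ → ℕ} {c : ℕ} (hh : ∀ i, i ≤ c → h i = h' i) :
    heightList h c = heightList h' c := by
  induction c with
  | zero => rfl
  | succ c ih => rw [heightList, heightList, hh _ le_rfl, ih fun i hi => hh i (by omega)]

lemma exists_heightList_eq (l : List ℕ) (hl : l.Pairwise (· > ·)) :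
    ∃ h : ℕ → ℕ, (∀ i j, 1 ≤ i → i < j → j ≤ l.length → h i < h j) ∧
      heightList h l.length = l := by
  induction l with
  | nil => exact ⟨fun _ => 0, by simp; omega, rfl⟩
  | cons a l ih =>
    obtain ⟨ha, hl⟩ := List.pairwise_cons.1 hl
    obtain ⟨h, hlt, heq⟩ := ih hl
    have hcongr : ∀ i, i ≤ l.length → Function.update h (l.length + 1) a i = h i :=
      fun i hi => Function.update_of_ne (by omega) _ _
    refine ⟨Function.update h (l.length + 1) a, ?_, ?_⟩
    · intro i j h1 h2 h3
      rw [List.length_cons] at h3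
      rw [hcongr i (by omega)]
      rcases Nat.lt_or_ge l.length j with hj | hj
      · obtain rfl : j = l.length + 1 := by omega
        rw [Function.update_self]
        exact ha _ (heq ▸ mem_heightList.2 ⟨i, h1, by omega, rfl⟩)
      · rw [hcongr j hj]
        exact hlt i j h1 h2 hj
    · rw [List.length_cons, heightList, Function.update_self, heightList_congr hcongr, heq]

lemma nonzeroHeights_eq (c : ℕ) (h : ℕ → ℕ) :
    nonzeroHeights c h = ((heightList h c).filter (fun x => x != 0)).reverse := by
  have : (List.range c).map (fun i => h (i + 1)) = (heightList h c).reverse := by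
    induction c with
    | zero => rfl
    | succ c ih => simp [List.range_succ, heightList, ih]
  rw [nonzeroHeights, this, List.filter_reverse]

lemma listRookNum_cons_congr {l l' : List ℕ} (a : ℕ) (h : listRookNum l = listRookNum l') :
    listRookNum (a :: l) = listRookNum (a :: l') := by
  ext k
  cases k <;> simp only [listRookNum, h]

lemma listRookNum_cons_injective {l l' : List ℕ} {a : ℕ}
    (h : listRookNum (a :: l) = listRookNum (a :: l')) : listRookNum l = listRookNum l' := by
  ext k
  induction k with
  | zero => simpa only [listRookNum] using congrFun h 0
  | succ k ih =>
    have := congrFun h (k + 1)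
    simp only [listRookNum, ih] at this
    exact add_right_cancel this

lemma listRookNum_zero_singleton : listRookNum [0] = listRookNum [] := by
  ext k
  match k with
  | 0 => simp [listRookNum]
  | 1 => simp [listRookNum]
  | k + 2 => simp [listRookNum]

lemma listRookNum_swap (a b : ℕ) (l : List ℕ) :
    listRookNum ((a + 1) :: b :: l) = listRookNum ((b + 1) :: a :: l) := by
  ext k
  match k with
  | 0 => simp [listRookNum]
  | 1 =>
    simp only [listRookNum]
    push_cast
    ring
  | k + 2 =>
    simp only [listRookNum]
    push_cast
    ring

lemma listRookNum_eq_zero_of_length_lt {l : List ℕ} {k : ℕ} (hk : l.length < k) :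
    listRookNum l k = 0 := by
  induction l generalizing k with
  | nil => cases k with
    | zero => simp at hk
    | succ k => rfl
  | cons a l ih => cases k with
    | zero => simp at hk
    | succ k =>
      rw [List.length_cons] at hk
      rw [listRookNum, ih (by omega), ih (by omega)]
      simp

lemma length_lt_of_pairwise_gt {l : List ℕ} {a : ℕ} (hl : (a :: l).Pairwise (· > ·))
    (hpos : ∀ b ∈ a :: l, 0 < b) : l.length < a := by
  induction l generalizing a with
  | nil => simpa using hpos
  | cons b l ih =>
    obtain ⟨ha, hl⟩ := List.pairwise_cons.1 hl
    have h1 := ih hl fun x hx => hpos x (List.mem_cons_of_mem _ hx)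
    have h2 := ha b List.mem_cons_self
    rw [List.length_cons]
    omega

lemma listRookNum_length_pos {l : List ℕ} (hl : l.Pairwise (· > ·)) (hpos : ∀ b ∈ l, 0 < b) :
    0 < listRookNum l l.length := by
  induction l with
  | nil => simp [listRookNum]
  | cons a l ih =>
    have ha := length_lt_of_pairwise_gt hl hpos
    rw [List.length_cons, listRookNum, listRookNum_eq_zero_of_length_lt (Nat.lt_succ_self _),
      zero_add]
    refine mul_pos (ih (List.pairwise_cons.1 hl).2
      fun x hx => hpos x (List.mem_cons_of_mem _ hx)) ?_
    omega

/-- Adding a column to an increasing board with few enough columns gives a board rook equivalent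
to an increasing one. -/
lemma exists_increasing_cons (l : List ℕ) (a : ℕ) (hl : l.Pairwise (· > ·))
    (hpos : ∀ b ∈ l, 0 < b) (hlen : l.length ≤ a) :
    ∃ l' : List ℕ, l'.Pairwise (· > ·) ∧ (∀ b ∈ l', 0 < b) ∧ l'.length ≤ a ∧
      (∀ m, a ≤ m → (∀ b ∈ l, b < m) → ∀ b ∈ l', b ≤ m) ∧
      listRookNum l' = listRookNum (a :: l) := by
  induction l generalizing a with
  | nil =>
    rcases Nat.eq_zero_or_pos a with rfl | ha
    · exact ⟨[], by simp, by simp, by simp, by simp, listRookNum_zero_singleton.symm⟩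
    · exact ⟨[a], by simp, by simpa using ha, ha, by simp, rfl⟩
  | cons b l ih =>
    rcases Nat.lt_or_ge b a with hab | hab
    · have hb := length_lt_of_pairwise_gt hl hpos
      refine ⟨a :: b :: l, List.pairwise_cons.2 ⟨?_, hl⟩, ?_, ?_, ?_, rfl⟩
      · intro x hx
        rcases List.mem_cons.1 hx with rfl | hx
        · exact hab
        · exact ((List.pairwise_cons.1 hl).1 x hx).trans hab
      · intro x hx
        rcases List.mem_cons.1 hx with rfl | hx
        · omega
        · exact hpos x hx
      · simp only [List.length_cons]
        omega
      · intro m hm hlt x hx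
        rcases List.mem_cons.1 hx with rfl | hx
        · exact hm
        · exact (hlt x hx).le
    · rw [List.length_cons] at hlen
      obtain ⟨a, rfl⟩ : ∃ a', a = a' + 1 := ⟨a - 1, by omega⟩
      obtain ⟨hb, hl⟩ := List.pairwise_cons.1 hl
      obtain ⟨l', h1, h2, h3, h4, h5⟩ :=
        ih a hl (fun x hx => hpos x (List.mem_cons_of_mem _ hx)) (by omega)
      refine ⟨(b + 1) :: l', List.pairwise_cons.2 ⟨?_, h1⟩, ?_, ?_, ?_, ?_⟩
      · exact fun x hx => Nat.lt_succ_of_le (h4 b (by omega) hb x hx)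
      · intro x hx
        rcases List.mem_cons.1 hx with rfl | hx
        · omega
        · exact h2 x hx
      · rw [List.length_cons]
        omega
      · intro m hm hlt x hx
        rcases List.mem_cons.1 hx with rfl | hx
        · exact hlt b List.mem_cons_self
        · exact h4 m (by omega) (fun y hy => hlt y (List.mem_cons_of_mem _ hy)) x hx
      · rw [listRookNum_cons_congr _ h5, listRookNum_swap]

lemma exists_increasing (L : List ℕ) (hL : L.Pairwise (· ≥ ·)) :
    ∃ l : List ℕ, l.Pairwise (· > ·) ∧ (∀ b ∈ l, 0 < b) ∧
      (∀ a, (∀ b ∈ L, b ≤ a) → l.length ≤ a) ∧ listRookNum l = listRookNum L := by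
  induction L with
  | nil => exact ⟨[], by simp, by simp, by simp, rfl⟩
  | cons a L ih =>
    obtain ⟨ha, hL⟩ := List.pairwise_cons.1 hL
    obtain ⟨l, h1, h2, h3, h4⟩ := ih hL
    obtain ⟨l', h1', h2', h3', -, h4'⟩ := exists_increasing_cons l a h1 h2 (h3 a ha)
    exact ⟨l', h1', h2', fun m hm => h3'.trans (hm a List.mem_cons_self),
      h4'.trans (listRookNum_cons_congr a h4)⟩

lemma pairwise_ge_heightList {h : ℕ → ℕ} {c : ℕ}
    (hmono : ∀ i j, 1 ≤ i → i ≤ j → j ≤ c → h i ≤ h j) :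
    (heightList h c).Pairwise (· ≥ ·) := by
  induction c with
  | zero => exact List.Pairwise.nil
  | succ c ih =>
    refine List.pairwise_cons.2 ⟨fun a ha => ?_, ih fun i j h1 h2 h3 => hmono i j h1 h2 (by omega)⟩
    obtain ⟨i, h1, h2, rfl⟩ := mem_heightList.1 ha
    exact hmono i (c + 1) h1 (by omega) le_rfl

/-- The value at `x` of the factorial rook polynomial, in factored form. -/
def factorialRookEval (x : ℤ) : List ℕ → ℤ
  | [] => 1
  | a :: l => (x + a - l.length) * factorialRookEval x l

/-- The Goldman–Joichi–White factorization. -/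
lemma sum_listRookNum_mul_descPochhammer (x : ℤ) (l : List ℕ) :
    ∑ k ∈ Finset.range (l.length + 1),
      listRookNum l k * (descPochhammer ℤ (l.length - k)).eval x = factorialRookEval x l := by
  induction l with
  | nil => simp [listRookNum, factorialRookEval]
  | cons a l ih =>
    have hshift : ∑ k ∈ Finset.range (l.length + 1),
        listRookNum l (k + 1) * (descPochhammer ℤ (l.length - k)).eval x +
          listRookNum l 0 * (descPochhammer ℤ (l.length + 1)).eval x =
        ∑ k ∈ Finset.range (l.length + 1),
          listRookNum l k * (descPochhammer ℤ (l.length + 1 - k)).eval x := by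
      have h1 := Finset.sum_range_succ' (fun k =>
        listRookNum l k * (descPochhammer ℤ (l.length + 1 - k)).eval x) (l.length + 1)
      have h2 := Finset.sum_range_succ (fun k =>
        listRookNum l k * (descPochhammer ℤ (l.length + 1 - k)).eval x) (l.length + 1)
      simp only [listRookNum_eq_zero_of_length_lt (Nat.lt_succ_self _), zero_mul, add_zero] at h2
      simp only [Nat.add_sub_add_right, Nat.sub_zero] at h1
      rw [← h1, h2]
    rw [List.length_cons, Finset.sum_range_succ', factorialRookEval, ← ih, Finset.mul_sum]
    simp only [listRookNum, Nat.add_sub_add_right, Nat.sub_zero, add_mul,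
      Finset.sum_add_distrib]
    rw [add_right_comm, hshift, ← Finset.sum_add_distrib]
    refine Finset.sum_congr rfl fun k hk => ?_
    have hk : k ≤ l.length := Nat.lt_succ_iff.1 (Finset.mem_range.1 hk)
    rw [Nat.succ_sub hk, descPochhammer_succ_eval, Nat.cast_sub hk]
    ring

lemma factorialRookEval_ne_zero {x : ℤ} {l : List ℕ} (hl : l.Pairwise (· > ·))
    (hx : ∀ b ∈ l, x + b + 1 - l.length < 0) : factorialRookEval x l ≠ 0 := by
  induction l with
  | nil => simp [factorialRookEval]
  | cons a l ih =>
    obtain ⟨ha, hl⟩ := List.pairwise_cons.1 hl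
    have h0 := hx a List.mem_cons_self
    rw [List.length_cons] at h0
    push_cast at h0
    refine mul_ne_zero (by omega) (ih hl fun b hb => ?_)
    have := ha b hb
    omega

lemma head_le_of_listRookNum_eq {a b : ℕ} {l m : List ℕ} (hl : (a :: l).Pairwise (· > ·))
    (hlen : l.length = m.length) (h : listRookNum (a :: l) = listRookNum (b :: m)) : b ≤ a := by
  by_contra! hab
  refine factorialRookEval_ne_zero (x := l.length - b) hl (fun c hc => ?_) ?_
  · have : c ≤ a := by
      rcases List.mem_cons.1 hc with rfl | hc
      · exact le_rfl
      · exact ((List.pairwise_cons.1 hl).1 c hc).le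
    rw [List.length_cons]
    push_cast
    omega
  · rw [← sum_listRookNum_mul_descPochhammer, h, List.length_cons, hlen, ← List.length_cons (a := b),
      sum_listRookNum_mul_descPochhammer, factorialRookEval]
    simp

lemma eq_of_listRookNum_eq {l m : List ℕ} (hl : l.Pairwise (· > ·)) (hm : m.Pairwise (· > ·))
    (hlen : l.length = m.length) (h : listRookNum l = listRookNum m) : l = m := by
  induction l generalizing m with
  | nil => exact (List.length_eq_zero_iff.1 hlen.symm).symm
  | cons a l ih =>
    cases m with
    | nil => simp at hlen
    | cons b m =>
      have hlen' : l.length = m.length := by simpa using hlen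
      obtain rfl : a = b := le_antisymm (head_le_of_listRookNum_eq hm hlen'.symm h.symm)
        (head_le_of_listRookNum_eq hl hlen' h)
      rw [ih (List.pairwise_cons.1 hl).2 (List.pairwise_cons.1 hm).2 hlen'
        (listRookNum_cons_injective h)]

lemma length_le_of_listRookNum_eq {l m : List ℕ} (hl : l.Pairwise (· > ·))
    (hpos : ∀ b ∈ l, 0 < b) (h : listRookNum l = listRookNum m) : l.length ≤ m.length := by
  by_contra! hlt
  have := listRookNum_length_pos hl hpos
  rw [h, listRookNum_eq_zero_of_length_lt hlt] at this
  exact this.false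

lemma listRookNum_filter_ne_zero {l : List ℕ} (hl : l.Pairwise (· > ·)) :
    listRookNum (l.filter (fun x => x != 0)) = listRookNum l := by
  induction l with
  | nil => rfl
  | cons a l ih =>
    obtain ⟨ha, hl⟩ := List.pairwise_cons.1 hl
    rcases Nat.eq_zero_or_pos a with rfl | hpos
    · obtain rfl : l = [] := List.eq_nil_iff_forall_not_mem.2 fun b hb => Nat.not_lt_zero _ (ha b hb)
      exact listRookNum_zero_singleton.symm
    · rw [List.filter_cons_of_pos (by simpa using hpos.ne')]
      exact listRookNum_cons_congr a (ih hl)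

/-- **Foata–Schützenberger.**  Every Ferrers board is rook equivalent to an increasing
Ferrers board, and any two rook-equivalent increasing Ferrers boards have the same height
vector up to columns of zero height. -/
theorem foata_schutzenberger (c : ℕ) (h : ℕ → ℕ)
    (hmono : ∀ i j, 1 ≤ i → i ≤ j → j ≤ c → h i ≤ h j) :
    (∃ (c' : ℕ) (h' : ℕ → ℕ),
      (∀ i j, 1 ≤ i → i < j → j ≤ c' → h' i < h' j) ∧
      ∀ k, rookNum (ferrersBoard c h) k = rookNum (ferrersBoard c' h') k) ∧
    (∀ (c₁ c₂ : ℕ) (h₁ h₂ : ℕ → ℕ),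
      (∀ i j, 1 ≤ i → i < j → j ≤ c₁ → h₁ i < h₁ j) →
      (∀ i j, 1 ≤ i → i < j → j ≤ c₂ → h₂ i < h₂ j) →
      (∀ k, rookNum (ferrersBoard c₁ h₁) k = rookNum (ferrersBoard c₂ h₂) k) →
      nonzeroHeights c₁ h₁ = nonzeroHeights c₂ h₂) := by
  have weak : ∀ (c : ℕ) (h : ℕ → ℕ), (∀ i j, 1 ≤ i → i < j → j ≤ c → h i < h j) →
      ∀ i j, 1 ≤ i → i ≤ j → j ≤ c → h i ≤ h j := by
    intro c h hlt i j h1 h2 h3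
    rcases h2.eq_or_lt with rfl | h2
    · exact le_rfl
    · exact (hlt i j h1 h2 h3).le
  refine ⟨?_, ?_⟩
  · obtain ⟨l, hl, -, -, hR⟩ := exists_increasing _ (pairwise_ge_heightList hmono)
    obtain ⟨h', hlt, heq⟩ := exists_heightList_eq l hl
    refine ⟨l.length, h', hlt, fun k => ?_⟩
    rw [← Nat.cast_inj (R := ℤ), rookNum_ferrersBoard hmono, rookNum_ferrersBoard (weak _ _ hlt),
      heq, hR]
  · intro c₁ c₂ h₁ h₂ hlt₁ hlt₂ hk
    have hp₁ := pairwise_heightList hlt₁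
    have hp₂ := pairwise_heightList hlt₂
    have hR : listRookNum ((heightList h₁ c₁).filter (fun x => x != 0)) =
        listRookNum ((heightList h₂ c₂).filter (fun x => x != 0)) := by
      rw [listRookNum_filter_ne_zero hp₁, listRookNum_filter_ne_zero hp₂]
      ext k
      rw [← rookNum_ferrersBoard (weak _ _ hlt₁), ← rookNum_ferrersBoard (weak _ _ hlt₂), hk]
    have hpos : ∀ l : List ℕ, ∀ b ∈ l.filter (fun x => x != 0), 0 < b := by
      intro l b hb
      exact Nat.pos_of_ne_zero (by simpa using (List.mem_filter.1 hb).2)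
    rw [nonzeroHeights_eq, nonzeroHeights_eq]
    exact congrArg _ (eq_of_listRookNum_eq (hp₁.filter _) (hp₂.filter _)
      (le_antisymm (length_le_of_listRookNum_eq (hp₁.filter _) (hpos _) hR)
        (length_le_of_listRookNum_eq (hp₂.filter _) (hpos _) hR.symm)) hR)
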